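/- Let X be a finite set and N ≥ 3 an integer with N ≤ |X|. Let B_N(X) = { λ ∈ ℝ^X : λᵀ𝟏 = 1, λ(i) ∈ {0, 1/N} for all i }, and define Γ̃₃ = { (1/(N(N−1)(N−2))) [ N³ λ⊗λ⊗λ + 2N Σ_{l∈X} λ(l) e_l⊗e_l⊗e_l − N² Σ_{l∈X} λ(l) ( λ⊗e_l⊗e_l + e_l⊗λ⊗e_l + e_l⊗e_l⊗λ ) ] : λ ∈ B_N(X) }. Then the set of 3-marginals of elements of Π̃_{N,sym} (the symmetric probability distributions on X^N vanishing whenever two indices coincide) equals conv(Γ̃₃). -/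

import Mathlib

/-- Indicator (standard basis) vector of `c ∈ X`. -/
def stdBasis {X : Type*} [DecidableEq X] (c : X) : X → ℝ :=
  fun x => if x = c then 1 else 0

/-- Symmetric probability distributions on `X^N` vanishing whenever two indices coincide. -/
def PiTildeSym (X : Type*) [Fintype X] [DecidableEq X] (N : ℕ) :
    Set ((Fin N → X) → ℝ) :=
  { μ | (∀ z, 0 ≤ μ z) ∧ (∑ z, μ z = 1) ∧
      (∀ (σ : Equiv.Perm (Fin N)) (z : Fin N → X), μ (z ∘ σ) = μ z) ∧
      (∀ z : Fin N → X, (∃ k l : Fin N, k ≠ l ∧ z k = z l) → μ z = 0) }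

/-- The set of binarized probability vectors on `X` with entries in `{0, 1/N}`. -/
def BN (X : Type*) [Fintype X] (N : ℕ) : Set (X → ℝ) :=
  { l | (∑ i, l i = 1) ∧ ∀ i, l i = 0 ∨ l i = 1 / N }

/-- The set `Γ̃₃` of candidate extreme points of the `N`-representable 3-marginals. -/
def GammaTilde3 (X : Type*) [Fintype X] [DecidableEq X] (N : ℕ) :
    Set (X → X → X → ℝ) :=
  { κ | ∃ lam ∈ BN X N,
      κ = fun i j k => (1 / ((N : ℝ) * ((N : ℝ) - 1) * ((N : ℝ) - 2))) *
          ((N : ℝ) ^ 3 * (lam i * lam j * lam k)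
            + 2 * (N : ℝ) *
              ∑ l : X, lam l * (stdBasis l i * stdBasis l j * stdBasis l k)
            - (N : ℝ) ^ 2 *
              ∑ l : X, lam l *
                (lam i * stdBasis l j * stdBasis l k
                  + stdBasis l i * lam j * stdBasis l k
                  + stdBasis l i * stdBasis l j * lam k)) }

open Finset

/-- The tensor of `Γ̃₃` attached to the vector `lam`. -/
noncomputable def gammaTensor {X : Type*} [Fintype X] [DecidableEq X] (N : ℕ) (lam : X → ℝ) :
    X → X → X → ℝ :=
  fun i j k => (1 / ((N : ℝ) * ((N : ℝ) - 1) * ((N : ℝ) - 2))) *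
    ((N : ℝ) ^ 3 * (lam i * lam j * lam k)
      + 2 * (N : ℝ) *
        ∑ l : X, lam l * (stdBasis l i * stdBasis l j * stdBasis l k)
      - (N : ℝ) ^ 2 *
        ∑ l : X, lam l *
          (lam i * stdBasis l j * stdBasis l k
            + stdBasis l i * lam j * stdBasis l k
            + stdBasis l i * stdBasis l j * lam k))

/-- The empirical distribution of a configuration `z : Fin N → X`. -/
noncomputable def empirical {X : Type*} [DecidableEq X] {N : ℕ} (z : Fin N → X) : X → ℝ :=
  fun i => (1 / (N : ℝ)) * ∑ p, if z p = i then 1 else 0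

/-- The indicator of `p`, `q`, `r` being pairwise distinct, in inclusion-exclusion form. -/
def distinctIndicator {ι : Type*} [DecidableEq ι] (p q r : ι) : ℝ :=
  1 - (if p = q then 1 else 0) - (if q = r then 1 else 0) - (if p = r then 1 else 0)
    + 2 * ((if p = q then 1 else 0) * (if q = r then 1 else 0))

theorem distinctIndicator_eq_ite {ι : Type*} [DecidableEq ι] (p q r : ι) :
    distinctIndicator p q r = if p ≠ q ∧ q ≠ r ∧ p ≠ r then 1 else 0 := by
  unfold distinctIndicator
  by_cases h₁ : p = q <;> by_cases h₂ : q = r <;> by_cases h₃ : p = r <;>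
    simp_all; norm_num

theorem sum_distinctIndicator_mul {ι : Type*} [Fintype ι] [DecidableEq ι] (f g h : ι → ℝ) :
    ∑ p, ∑ q, ∑ r, distinctIndicator p q r * (f p * g q * h r) =
      (∑ p, f p) * (∑ p, g p) * (∑ p, h p) - (∑ p, f p * g p) * (∑ p, h p)
        - (∑ p, f p) * (∑ p, g p * h p) - (∑ p, f p * h p) * (∑ p, g p)
        + 2 * ∑ p, f p * g p * h p := by
  have e (p q r : ι) : distinctIndicator p q r * (f p * g q * h r) =
      f p * g q * h r - (if p = q then f p * g q * h r else 0)
        - (if q = r then f p * g q * h r else 0) - (if p = r then f p * g q * h r else 0)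
        + 2 * (if p = q then if q = r then f p * g q * h r else 0 else 0) := by
    unfold distinctIndicator
    split_ifs <;> ring
  have swap (p : ι) : ∑ q, ∑ r, (if p = q then f p * g q * h r else 0) =
      f p * g p * ∑ r, h r := by
    rw [sum_comm]; simp [mul_sum]
  have triple (p : ι) :
      ∑ q, ∑ r, (if p = q then if q = r then f p * g q * h r else 0 else 0) =
      f p * g p * h p := by
    rw [sum_comm]; simp
  simp only [e, sum_add_distrib, sum_sub_distrib, ← mul_sum, swap, triple]
  simp only [sum_ite_eq, mem_univ, if_true, ← sum_mul, ← mul_sum, mul_assoc]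
  rw [sum_mul (f := fun p => f p * g p), sum_mul (f := fun p => f p * h p)]
  simp only [mul_assoc, mul_comm (h _) (∑ q, g q)]

theorem sum_distinctIndicator (N : ℕ) :
    ∑ p : Fin N, ∑ q, ∑ r, distinctIndicator p q r = (N : ℝ) * (N - 1) * (N - 2) := by
  have h := sum_distinctIndicator_mul (ι := Fin N) (fun _ => 1) (fun _ => 1) (fun _ => 1)
  simp only [mul_one, sum_const, card_univ, Fintype.card_fin, nsmul_eq_mul] at h
  rw [h]; ring

theorem exists_perm_apply_eq {α : Type*} {a b c p q r : α}
    (hab : a ≠ b) (hbc : b ≠ c) (hac : a ≠ c) (hpq : p ≠ q) (hqr : q ≠ r) (hpr : p ≠ r) :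
    ∃ σ : Equiv.Perm α, σ a = p ∧ σ b = q ∧ σ c = r := by
  classical
  have inj {x y z : α} (hxy : x ≠ y) (hyz : y ≠ z) (hxz : x ≠ z) :
      Function.Injective ![x, y, z] := by
    intro s t
    fin_cases s <;> fin_cases t <;> simp [hxy, hyz, hxz, hxy.symm, hyz.symm, hxz.symm]
  obtain ⟨σ, hσ⟩ := (Equiv.Perm.isMultiplyPretransitive α 3).exists_smul_eq
    (⟨_, inj hab hbc hac⟩ : Fin 3 ↪ α) ⟨_, inj hpq hqr hpr⟩
  refine ⟨σ, ?_, ?_, ?_⟩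
  · simpa using congrArg (fun e : Fin 3 ↪ α => e 0) hσ
  · simpa using congrArg (fun e : Fin 3 ↪ α => e 1) hσ
  · simpa using congrArg (fun e : Fin 3 ↪ α => e 2) hσ

section Empirical

variable {X : Type*} [DecidableEq X] {N : ℕ}

theorem empirical_of_injective {z : Fin N → X} (hz : Function.Injective z) (p : Fin N) :
    empirical z (z p) = 1 / N := by
  simp [empirical, hz.eq_iff]

theorem empirical_of_notMem_range {z : Fin N → X} {i : X} (hi : i ∉ Set.range z) :
    empirical z i = 0 := by
  have (p : Fin N) : z p ≠ i := fun h => hi ⟨p, h⟩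
  simp [empirical, this]

theorem empirical_comp_perm (z : Fin N → X) (σ : Equiv.Perm (Fin N)) :
    empirical (z ∘ σ) = empirical z := by
  ext i
  exact congrArg _ (Equiv.sum_comp σ fun p => if z p = i then (1 : ℝ) else 0)

end Empirical

section Marginals

variable {X : Type*} [Fintype X] [DecidableEq X] {N : ℕ}

/-- The marginal of `μ` on the coordinates `p`, `q`, `r`. -/
def tripleMarginal (μ : (Fin N → X) → ℝ) (p q r : Fin N) : X → X → X → ℝ :=
  fun i j k => ∑ z ∈ univ.filter (fun z : Fin N → X => z p = i ∧ z q = j ∧ z r = k), μ z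

theorem tripleMarginal_eq_sum (μ : (Fin N → X) → ℝ) (p q r : Fin N) (i j k : X) :
    tripleMarginal μ p q r i j k = ∑ z, μ z *
      ((if z p = i then 1 else 0) * (if z q = j then 1 else 0) *
        (if z r = k then 1 else 0)) := by
  unfold tripleMarginal
  rw [sum_filter]
  refine sum_congr rfl fun z _ => ?_
  by_cases h₁ : z p = i <;> by_cases h₂ : z q = j <;> by_cases h₃ : z r = k <;> simp [h₁, h₂, h₃]

theorem tripleMarginal_perm {μ : (Fin N → X) → ℝ}
    (hμ : ∀ (σ : Equiv.Perm (Fin N)) (z : Fin N → X), μ (z ∘ σ) = μ z)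
    (σ : Equiv.Perm (Fin N)) (p q r : Fin N) :
    tripleMarginal μ (σ p) (σ q) (σ r) = tripleMarginal μ p q r := by
  ext i j k
  rw [tripleMarginal_eq_sum, tripleMarginal_eq_sum]
  refine Fintype.sum_equiv (σ.symm.arrowCongr (Equiv.refl X)) _ _ fun z => ?_
  have : (σ.symm.arrowCongr (Equiv.refl X)) z = z ∘ σ := rfl
  rw [this, hμ]
  rfl

theorem gammaTensor_empirical (hN : 3 ≤ N) (z : Fin N → X) (i j k : X) :
    (N : ℝ) * (N - 1) * (N - 2) * gammaTensor N (empirical z) i j k =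
      ∑ p, ∑ q, ∑ r, distinctIndicator p q r *
        ((if z p = i then 1 else 0) * (if z q = j then 1 else 0) *
          (if z r = k then 1 else 0)) := by
  have hN' : (3 : ℝ) ≤ N := by exact_mod_cast hN
  have h0 : (N : ℝ) ≠ 0 := by linarith
  have h1 : (N : ℝ) - 1 ≠ 0 := by linarith
  have h2 : (N : ℝ) - 2 ≠ 0 := by linarith
  rw [sum_distinctIndicator_mul]
  have pair (x y : X) : ∑ p, ((if z p = x then (1 : ℝ) else 0) * (if z p = y then 1 else 0)) =
      (if x = y then 1 else 0) * ∑ p, if z p = x then (1 : ℝ) else 0 := by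
    rw [mul_sum]
    refine sum_congr rfl fun p _ => ?_
    by_cases h : z p = x <;> simp [h]
  have triple : ∑ p, ((if z p = i then (1 : ℝ) else 0) * (if z p = j then 1 else 0) *
        (if z p = k then 1 else 0)) =
      (if i = j then 1 else 0) * (if i = k then 1 else 0) *
        ∑ p, if z p = i then (1 : ℝ) else 0 := by
    rw [mul_sum]
    refine sum_congr rfl fun p _ => ?_
    by_cases h : z p = i <;> simp [h]
  rw [pair, pair, pair, triple]
  have count (x : X) : ∑ p, (if z p = x then (1 : ℝ) else 0) = N * empirical z x := by
    unfold empirical; field_simp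
  simp only [count]
  generalize empirical z = lam
  have diag : ∑ l : X, lam l * (stdBasis l i * stdBasis l j * stdBasis l k) =
      (if i = j then 1 else 0) * (if i = k then 1 else 0) * lam i := by
    rw [sum_eq_single i (fun l _ hl => by simp [stdBasis, hl.symm]) (by simp)]
    simp only [stdBasis, eq_comm (a := j), eq_comm (a := k), if_true]; ring
  have offdiag : ∑ l : X, lam l * (lam i * stdBasis l j * stdBasis l k
        + stdBasis l i * lam j * stdBasis l k + stdBasis l i * stdBasis l j * lam k) =
      (if j = k then 1 else 0) * lam j * lam i + (if i = k then 1 else 0) * lam i * lam j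
        + (if i = j then 1 else 0) * lam i * lam k := by
    simp only [mul_add, sum_add_distrib]
    congr 1
    · congr 1
      · rw [sum_eq_single j (fun l _ hl => by simp [stdBasis, hl.symm]) (by simp)]
        simp only [stdBasis, eq_comm (a := k), if_true]; ring
      · rw [sum_eq_single i (fun l _ hl => by simp [stdBasis, hl.symm]) (by simp)]
        simp only [stdBasis, eq_comm (a := k), if_true]; ring
    · rw [sum_eq_single i (fun l _ hl => by simp [stdBasis, hl.symm]) (by simp)]
      simp only [stdBasis, eq_comm (a := j), if_true]; ring
  unfold gammaTensor
  rw [diag, offdiag, ← mul_assoc, mul_one_div_cancel (by positivity), one_mul]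
  ring

/-- The marginal of a symmetric `μ` on three distinct coordinates is the `μ`-average of the
tensors attached to empirical distributions. -/
theorem tripleMarginal_eq_sum_gammaTensor (hN : 3 ≤ N) {μ : (Fin N → X) → ℝ}
    (hμ : ∀ (σ : Equiv.Perm (Fin N)) (z : Fin N → X), μ (z ∘ σ) = μ z)
    {a b c : Fin N} (hab : a ≠ b) (hbc : b ≠ c) (hac : a ≠ c) :
    tripleMarginal μ a b c = ∑ z, μ z • gammaTensor N (empirical z) := by
  have hN' : (3 : ℝ) ≤ N := by exact_mod_cast hN
  have h0 : (N : ℝ) ≠ 0 := by linarith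
  have h1 : (N : ℝ) - 1 ≠ 0 := by linarith
  have h2 : (N : ℝ) - 2 ≠ 0 := by linarith
  ext i j k
  refine mul_left_cancel₀ (mul_ne_zero (mul_ne_zero h0 h1) h2) ?_
  calc (N : ℝ) * (N - 1) * (N - 2) * tripleMarginal μ a b c i j k
      = ∑ p, ∑ q, ∑ r, distinctIndicator p q r * tripleMarginal μ p q r i j k := by
        rw [← sum_distinctIndicator]
        simp only [sum_mul]
        refine sum_congr rfl fun p _ => sum_congr rfl fun q _ => sum_congr rfl fun r _ => ?_
        rw [distinctIndicator_eq_ite]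
        split_ifs with h
        · obtain ⟨σ, rfl, rfl, rfl⟩ := exists_perm_apply_eq hab hbc hac h.1 h.2.1 h.2.2
          rw [tripleMarginal_perm hμ]
        · simp
    _ = ∑ z, μ z * ∑ p, ∑ q, ∑ r, distinctIndicator p q r *
          ((if z p = i then 1 else 0) * (if z q = j then 1 else 0) *
            (if z r = k then 1 else 0)) := by
        simp only [tripleMarginal_eq_sum, mul_sum]
        simp only [sum_comm (s := univ (α := Fin N)) (t := univ (α := Fin N → X))]
        refine sum_congr rfl fun z _ => sum_congr rfl fun p _ => sum_congr rfl fun q _ =>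
          sum_congr rfl fun r _ => ?_
        ring
    _ = _ := by
        simp only [← gammaTensor_empirical hN, Finset.sum_apply, Pi.smul_apply, smul_eq_mul,
          mul_sum]
        exact sum_congr rfl fun z _ => by ring

theorem sum_empirical (hN : N ≠ 0) (z : Fin N → X) : ∑ i, empirical z i = 1 := by
  unfold empirical
  rw [← mul_sum, sum_comm]
  simp [hN]

theorem empirical_mem_BN (hN : N ≠ 0) {z : Fin N → X} (hz : Function.Injective z) :
    empirical z ∈ BN X N := by
  refine ⟨sum_empirical hN z, fun i => ?_⟩
  by_cases hi : i ∈ Set.range z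
  · obtain ⟨p, rfl⟩ := hi
    exact Or.inr (empirical_of_injective hz p)
  · exact Or.inl (empirical_of_notMem_range hi)

theorem injective_of_empirical_mem_BN {z : Fin N → X} (hz : empirical z ∈ BN X N) :
    Function.Injective z := by
  intro k l hkl
  by_contra hne
  have hN : (0 : ℝ) < N := by exact_mod_cast k.pos
  have two : (2 : ℝ) ≤ ∑ p, if z p = z k then (1 : ℝ) else 0 :=
    calc (2 : ℝ) = ∑ p ∈ {k, l}, if z p = z k then (1 : ℝ) else 0 := by
          rw [sum_pair hne]; simp [hkl]; norm_num
      _ ≤ _ := sum_le_sum_of_subset_of_nonneg (subset_univ _) fun p _ _ => by split_ifs <;> simp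
  have count : (N : ℝ) * empirical z (z k) = ∑ p, if z p = z k then (1 : ℝ) else 0 := by
    unfold empirical; field_simp
  rcases hz.2 (z k) with h | h
  · rw [h] at count; linarith
  · rw [h, mul_one_div_cancel hN.ne'] at count; linarith

theorem exists_empirical_eq (hN : N ≠ 0) {lam : X → ℝ} (hlam : lam ∈ BN X N) :
    ∃ z : Fin N → X, empirical z = lam := by
  have hN' : (N : ℝ) ≠ 0 := by exact_mod_cast hN
  have hcard : Fintype.card {i // lam i ≠ 0} = N := by
    have key : ∑ i, lam i = ∑ i, if lam i ≠ 0 then 1 / (N : ℝ) else 0 := by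
      refine sum_congr rfl fun i _ => ?_
      split_ifs with h
      · exact (hlam.2 i).resolve_left h
      · exact not_not.mp h
    rw [hlam.1, ← sum_filter, sum_const, nsmul_eq_mul] at key
    rw [Fintype.card_subtype]
    field_simp at key
    exact_mod_cast key.symm
  let e := (Fintype.equivFinOfCardEq hcard).symm
  refine ⟨fun p => (e p : X), ?_⟩
  have hinj : Function.Injective fun p => (e p : X) :=
    Subtype.val_injective.comp e.injective
  ext i
  by_cases hi : lam i = 0
  · rw [hi]
    exact empirical_of_notMem_range fun ⟨p, hp⟩ => (e p).2 ((congrArg lam hp).trans hi)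
  · rw [(hlam.2 i).resolve_left hi]
    simpa using empirical_of_injective hinj (e.symm ⟨i, hi⟩)

/-- The uniform distribution on the configurations with a prescribed empirical distribution. -/
theorem exists_mem_PiTildeSym (hN : N ≠ 0) {lam : X → ℝ} (hlam : lam ∈ BN X N) :
    ∃ μ ∈ PiTildeSym X N, ∀ z, μ z ≠ 0 → empirical z = lam := by
  classical
  obtain ⟨w, hw⟩ := exists_empirical_eq hN hlam
  let S : Finset (Fin N → X) := univ.filter fun z => empirical z = lam
  have hS : (#S : ℝ) ≠ 0 := by
    exact_mod_cast (card_pos.mpr ⟨w, by simp [S, hw]⟩).ne'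
  refine ⟨fun z => if empirical z = lam then 1 / (#S : ℝ) else 0, ⟨fun z => ?_, ?_, ?_, ?_⟩, ?_⟩
  · dsimp only; split_ifs <;> positivity
  · rw [← sum_filter, sum_const, nsmul_eq_mul]
    exact mul_one_div_cancel hS
  · intro σ z
    simp only [empirical_comp_perm]
  · rintro z ⟨k, l, hkl, hz⟩
    refine if_neg fun h => hkl ?_
    exact injective_of_empirical_mem_BN (h ▸ hlam) hz
  · intro z hz
    by_contra h
    exact hz (if_neg h)

theorem convex_PiTildeSym : Convex ℝ (PiTildeSym X N) := by
  rintro μ ⟨h1, h2, h3, h4⟩ ν ⟨k1, k2, k3, k4⟩ a b ha hb hab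
  refine ⟨fun z => ?_, ?_, fun σ z => ?_, fun z hz => ?_⟩
  · exact add_nonneg (mul_nonneg ha (h1 z)) (mul_nonneg hb (k1 z))
  · simp [sum_add_distrib, ← mul_sum, h2, k2, hab]
  · simp [h3, k3]
  · simp [h4 z hz, k4 z hz]

theorem convex_image_tripleMarginal (p q r : Fin N) :
    Convex ℝ ((fun μ : (Fin N → X) → ℝ => tripleMarginal μ p q r) '' PiTildeSym X N) := by
  refine convex_PiTildeSym.is_linear_image ⟨fun μ ν => ?_, fun c μ => ?_⟩
  · ext i j k; simp [tripleMarginal, sum_add_distrib]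
  · ext i j k; simp [tripleMarginal, mul_sum]

end Marginals

theorem threeMarginals_eq_convexHull_GammaTilde3
    (X : Type*) [Fintype X] [DecidableEq X] (N : ℕ) (hN : 3 ≤ N)
    (hNX : N ≤ Fintype.card X) :
    { κ : X → X → X → ℝ | ∃ μ ∈ PiTildeSym X N,
        κ = fun i j k =>
          ∑ z ∈ Finset.univ.filter
            (fun z : Fin N → X =>
              z ⟨0, by omega⟩ = i ∧ z ⟨1, by omega⟩ = j ∧ z ⟨2, by omega⟩ = k), μ z }
      = convexHull ℝ (GammaTilde3 X N) := by
  have hN0 : N ≠ 0 := by omega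
  have marginal {μ : (Fin N → X) → ℝ} (hμ : μ ∈ PiTildeSym X N) :
      tripleMarginal μ ⟨0, by omega⟩ ⟨1, by omega⟩ ⟨2, by omega⟩ =
        ∑ z, μ z • gammaTensor N (empirical z) :=
    tripleMarginal_eq_sum_gammaTensor hN hμ.2.2.1 (by simp) (by simp) (by simp)
  apply Set.Subset.antisymm
  · rintro _ ⟨μ, hμ, rfl⟩
    change tripleMarginal μ ⟨0, by omega⟩ ⟨1, by omega⟩ ⟨2, by omega⟩ ∈ _
    rw [marginal hμ]
    have vanish {z : Fin N → X} (hz : ¬ Function.Injective z) : μ z = 0 := by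
      obtain ⟨k, l, hkl, hne⟩ := Function.not_injective_iff.mp hz
      exact hμ.2.2.2 z ⟨k, l, hne, hkl⟩
    rw [← sum_subset (filter_subset (fun z => Function.Injective z) univ)
      fun z _ hz => by rw [vanish (by simpa using hz), zero_smul]]
    refine (convex_convexHull ℝ _).sum_mem (fun z _ => hμ.1 z) ?_ fun z hz =>
      subset_convexHull ℝ _ ⟨_, empirical_mem_BN hN0 (mem_filter.mp hz).2, rfl⟩
    rw [← hμ.2.1]
    exact sum_subset (filter_subset _ _) fun z _ hz => vanish (by simpa using hz)
  · refine convexHull_min ?_ ?_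
    · rintro _ ⟨lam, hlam, rfl⟩
      obtain ⟨μ, hμ, hsupp⟩ := exists_mem_PiTildeSym hN0 hlam
      refine ⟨μ, hμ, ?_⟩
      change gammaTensor N lam = tripleMarginal μ ⟨0, by omega⟩ ⟨1, by omega⟩ ⟨2, by omega⟩
      rw [marginal hμ]
      have (z : Fin N → X) : μ z • gammaTensor N (empirical z) = μ z • gammaTensor N lam := by
        by_cases h : μ z = 0
        · simp [h]
        · rw [hsupp z h]
      simp only [this, ← sum_smul, hμ.2.1, one_smul]
    · have h := convex_image_tripleMarginal (X := X) (N := N) ⟨0, by omega⟩ ⟨1, by omega⟩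
        ⟨2, by omega⟩
      have e : (fun μ : (Fin N → X) → ℝ =>
            tripleMarginal μ ⟨0, by omega⟩ ⟨1, by omega⟩ ⟨2, by omega⟩) '' PiTildeSym X N =
          {κ | ∃ μ ∈ PiTildeSym X N,
            κ = tripleMarginal μ ⟨0, by omega⟩ ⟨1, by omega⟩ ⟨2, by omega⟩} :=
        Set.ext fun κ => exists_congr fun μ => and_congr_right fun _ => eq_comm
      rw [e] at h
      exact h
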